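/- arXiv:2308.02147 — 7 statements merged into one kernel-verified Lean document; each statement's English description precedes it below -/
import Mathlib

section
/- Let (Λ,Γ) be a bi-g-frame for U with respect to {V_j}_{j∈J} with bounds C and D. Then for every f ∈ U the family (Γ_j* (Λ_j f))_{j∈J} is summable in U, and the resulting operator S_{Λ,Γ} : U → U defined by S_{Λ,Γ} f = ∑_{j∈J} Γ_j* Λ_j f is a bounded linear operator with ‖S_{Λ,Γ}‖ ≤ D. -/
open scoped InnerProductSpace

variable {U : Type*} [NormedAddCommGroup U] [InnerProductSpace ℂ U] [CompleteSpace U]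
variable {J : Type*} {V : J → Type*} [∀ j, NormedAddCommGroup (V j)]
  [∀ j, InnerProductSpace ℂ (V j)] [∀ j, CompleteSpace (V j)]

/-- `(Λ, Γ)` is a bi-`g`-frame for `U` with respect to `{V j}` with bounds `C`, `D`:
for every `f`, the family of inner products `⟪Λ j f, Γ j f⟫` is summable, its sum is a
real number `s`, and `C‖f‖² ≤ s ≤ D‖f‖²`. -/
def IsBiGFrame (Λ Γ : ∀ j : J, U →L[ℂ] V j) (C D : ℝ) : Prop :=
  0 < C ∧ 0 < D ∧ ∀ f : U, ∃ s : ℝ,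
    HasSum (fun j : J => ⟪Λ j f, Γ j f⟫_ℂ) (s : ℂ) ∧
    C * ‖f‖ ^ 2 ≤ s ∧ s ≤ D * ‖f‖ ^ 2

/-- The signed finite partial sums of a weakly absolutely summable family in a Hilbert space are
bounded in norm. -/
theorem exists_norm_sum_smul_le_of_summable_inner {𝕜 E ι : Type*} [RCLike 𝕜]
    [NormedAddCommGroup E] [InnerProductSpace 𝕜 E] [CompleteSpace E] {x : ι → E}
    (hx : ∀ g : E, Summable fun i => inner 𝕜 (x i) g) :
    ∃ M : ℝ, ∀ (F : Finset ι) (c : ι → 𝕜), (∀ i, ‖c i‖ ≤ 1) → ‖∑ i ∈ F, c i • x i‖ ≤ M := by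
  obtain ⟨M, hM⟩ := banach_steinhaus
    (g := fun p : Finset ι × {c : ι → 𝕜 // ∀ i, ‖c i‖ ≤ 1} =>
      innerSL 𝕜 (∑ i ∈ p.1, p.2.1 i • x i)) fun g => by
    refine ⟨∑' i, ‖inner 𝕜 (x i) g‖, fun p => ?_⟩
    rw [innerSL_apply_apply, sum_inner]
    refine (norm_sum_le _ _).trans (le_trans (Finset.sum_le_sum fun i _ => ?_)
      ((hx g).norm.sum_le_tsum p.1 fun _ _ => norm_nonneg _))
    rw [inner_smul_left, norm_mul, RCLike.norm_conj]
    exact mul_le_of_le_one_left (norm_nonneg _) (p.2.2 i)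
  refine ⟨M, fun F c hc => ?_⟩
  simpa only [innerSL_apply_norm] using hM (F, ⟨c, hc⟩)

/-- The Orlicz–Pettis theorem in a Hilbert space: a weakly absolutely summable family is
summable. -/
theorem summable_of_summable_inner {𝕜 E ι : Type*} [RCLike 𝕜]
    [NormedAddCommGroup E] [InnerProductSpace 𝕜 E] [CompleteSpace E] {x : ι → E}
    (hx : ∀ g : E, Summable fun i => inner 𝕜 (x i) g) : Summable x := by
  classical
  obtain ⟨M, hM⟩ := exists_norm_sum_smul_le_of_summable_inner hx
  let T : Set ℝ :=
    {r | ∃ (F : Finset ι) (c : ι → 𝕜), (∀ i, ‖c i‖ ≤ 1) ∧ r = ‖∑ i ∈ F, c i • x i‖ ^ 2}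
  have hT : BddAbove T := by
    refine ⟨M ^ 2, ?_⟩
    rintro _ ⟨F, c, hc, rfl⟩
    exact pow_le_pow_left₀ (norm_nonneg _) (hM F c hc) 2
  have hne : T.Nonempty := ⟨_, ∅, 0, by simp, rfl⟩
  rw [summable_iff_vanishing_norm]
  intro ε hε
  obtain ⟨_, ⟨F, c, hc, rfl⟩, hlt⟩ :=
    exists_lt_of_lt_csSup hne (sub_lt_self (sSup T) (pow_pos hε 2))
  refine ⟨F, fun G hG => ?_⟩
  have key : ∀ d : 𝕜, ‖d‖ ≤ 1 →
      ‖∑ i ∈ F, c i • x i + d • ∑ i ∈ G, x i‖ ^ 2 ≤ sSup T := by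
    intro d hd
    refine le_csSup hT ⟨F ∪ G, fun i => if i ∈ F then c i else d, fun i => ?_, ?_⟩
    · dsimp only
      split_ifs
      exacts [hc i, hd]
    · rw [Finset.sum_union hG.symm, Finset.smul_sum]
      congr 3
      · exact Finset.sum_congr rfl fun i hi => by simp only [if_pos hi]
      · exact Finset.sum_congr rfl fun i hi => by
          simp only [if_neg (Finset.disjoint_left.mp hG hi)]
  have hadd := key 1 (by simp)
  have hsub := key (-1) (by simp)
  rw [one_smul] at hadd
  rw [neg_one_smul, ← sub_eq_add_neg] at hsub
  have hpar := parallelogram_law_with_norm 𝕜 (∑ i ∈ F, c i • x i) (∑ i ∈ G, x i)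
  exact lt_of_pow_lt_pow_left₀ 2 hε.le (by nlinarith)

/-- A linear map on a complex inner product space whose quadratic form is real and lies between
`0` and `D * ‖f‖ ^ 2` is bounded by `D`. -/
theorem LinearMap.norm_apply_le_of_inner_self {E : Type*} [NormedAddCommGroup E]
    [InnerProductSpace ℂ E] (S : E →ₗ[ℂ] E) {D : ℝ} (hD : 0 < D)
    (hS : ∀ f, ∃ s : ℝ, inner ℂ (S f) f = s ∧ 0 ≤ s ∧ s ≤ D * ‖f‖ ^ 2) (f : E) :
    ‖S f‖ ≤ D * ‖f‖ := by
  have hsym : S.IsSymmetric := by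
    rw [LinearMap.isSymmetric_iff_inner_map_self_real]
    intro v
    obtain ⟨s, hs, -⟩ := hS v
    rw [hs, Complex.conj_ofReal]
  have hre : ∀ v, 0 ≤ (inner ℂ (S v) v).re ∧ (inner ℂ (S v) v).re ≤ D * ‖v‖ ^ 2 := by
    intro v
    obtain ⟨s, hs, h⟩ := hS v
    rwa [hs, Complex.ofReal_re]
  set g : E := ((D⁻¹ : ℝ) : ℂ) • S f with hg
  have hfg : (inner ℂ (S f) g).re = D⁻¹ * ‖S f‖ ^ 2 := by
    rw [hg, inner_smul_right, Complex.re_ofReal_mul, inner_self_eq_norm_sq_to_K]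
    norm_cast
  have hgf : (inner ℂ (S g) f).re = D⁻¹ * ‖S f‖ ^ 2 := by
    rw [hsym g f, ← hfg]
    exact inner_re_symm (𝕜 := ℂ) _ _
  have hnorm : ‖f + g‖ ^ 2 = ‖f‖ ^ 2 + 2 * (D⁻¹ * (inner ℂ (S f) f).re) +
      (D⁻¹ * ‖S f‖) ^ 2 := by
    rw [norm_add_sq (𝕜 := ℂ), hg, norm_smul, inner_smul_right, ← hsym f f, RCLike.re_eq_complex_re,
      Complex.re_ofReal_mul, Complex.norm_real, Real.norm_of_nonneg (inv_pos.mpr hD).le]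
  have hadd := (hre (f + g)).2
  have hsub := (hre (f - g)).1
  rw [hnorm] at hadd
  simp only [map_add, map_sub, inner_add_left, inner_add_right, inner_sub_left, inner_sub_right,
    Complex.add_re, Complex.sub_re, hfg, hgf] at hadd hsub
  have hf := (hre f).2
  refine le_of_sq_le_sq ?_ (by positivity)
  have hexp : D * (‖f‖ ^ 2 + 2 * (D⁻¹ * (inner ℂ (S f) f).re) + (D⁻¹ * ‖S f‖) ^ 2) =
      D * ‖f‖ ^ 2 + 2 * (inner ℂ (S f) f).re + D⁻¹ * ‖S f‖ ^ 2 := by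
    field_simp
  have hle : D⁻¹ * ‖S f‖ ^ 2 ≤ D * ‖f‖ ^ 2 := by linarith
  rw [inv_mul_le_iff₀ hD] at hle
  linarith

/-- the bi-g-frame operator is well defined and bounded with norm ≤ D. -/
theorem biGFrame_operator_exists_bounded
    (Λ Γ : ∀ j : J, U →L[ℂ] V j) (C D : ℝ) (h : IsBiGFrame Λ Γ C D) :
    ∃ S : U →L[ℂ] U,
      (∀ f : U,
        HasSum (fun j : J => (ContinuousLinearMap.adjoint (Γ j)) (Λ j f)) (S f)) ∧
      ‖S‖ ≤ D := by
  obtain ⟨hC, hD, hfr⟩ := h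
  let A : J → U →L[ℂ] U := fun j => (ContinuousLinearMap.adjoint (Γ j)).comp (Λ j)
  have hA : ∀ j f, inner ℂ (A j f) f = inner ℂ (Λ j f) (Γ j f) := fun j f =>
    ContinuousLinearMap.adjoint_inner_left (Γ j) f (Λ j f)
  have hquad : ∀ f, Summable fun j => inner ℂ (A j f) f := by
    intro f
    obtain ⟨s, hs, -⟩ := hfr f
    simpa only [hA] using hs.summable
  have hsum : ∀ f, Summable fun j => A j f := by
    refine fun f => summable_of_summable_inner (𝕜 := ℂ) fun g => ?_
    have hpol := fun j => inner_map_polarization (A j).toLinearMap g f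
    simp only [ContinuousLinearMap.coe_coe] at hpol
    simp only [hpol]
    exact ((((hquad _).sub (hquad _)).add ((hquad _).mul_left _)).sub
      ((hquad _).mul_left _)).div_const _
  let S : U →ₗ[ℂ] U :=
    { toFun := fun f => ∑' j, A j f
      map_add' := fun f g => by simp only [map_add, (hsum f).tsum_add (hsum g)]
      map_smul' := fun c f => by
        simp only [map_smul, RingHom.id_apply, (hsum f).tsum_const_smul c] }
  have hS : ∀ f, ∃ s : ℝ, inner ℂ (S f) f = s ∧ 0 ≤ s ∧ s ≤ D * ‖f‖ ^ 2 := by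
    intro f
    obtain ⟨s, hs, hCs, hsD⟩ := hfr f
    refine ⟨s, ?_, le_trans (by positivity) hCs, hsD⟩
    simp only [← hA] at hs
    exact ((hsum f).hasSum.mapL ((innerSLFlip ℂ) f)).unique hs
  exact ⟨S.mkContinuous D (S.norm_apply_le_of_inner_self hD hS), fun f => (hsum f).hasSum,
    S.mkContinuous_norm_le hD.le _⟩
end

section
/- Let (Λ,Γ) be a bi-g-frame for U with respect to {V_j}_{j∈J} with bounds C and D. Then the bi-g-frame operator S_{Λ,Γ} : U → U is bijective (i.e. invertible as a bounded operator on U). -/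
open scoped InnerProductSpace

variable {U : Type*} [NormedAddCommGroup U] [InnerProductSpace ℂ U] [CompleteSpace U]
variable {J : Type*} {V : J → Type*} [∀ j, NormedAddCommGroup (V j)]
  [∀ j, InnerProductSpace ℂ (V j)] [∀ j, CompleteSpace (V j)]

/-- the bi-g-frame operator is bijective. -/
theorem biGFrame_operator_bijective
    (Λ Γ : ∀ j : J, U →L[ℂ] V j) (C D : ℝ) (h : IsBiGFrame Λ Γ C D)
    (S : U →L[ℂ] U)
    (hS : ∀ f : U,
      HasSum (fun j : J => (ContinuousLinearMap.adjoint (Γ j)) (Λ j f)) (S f)) :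
    Function.Bijective S := by
  obtain ⟨hC, -, hs⟩ := h
  lift C to NNReal using hC.le
  rw [← ContinuousLinearMap.isUnit_iff_bijective]
  refine ContinuousLinearMap.isUnit_of_forall_le_norm_inner_map S
    (c := C) (by exact_mod_cast hC) fun f => ?_
  obtain ⟨s, hsum, hle, -⟩ := hs f
  have hinner : HasSum (fun j : J => ⟪Λ j f, Γ j f⟫_ℂ) ⟪S f, f⟫_ℂ := by
    have h := ((hS f).mapL (innerSL ℂ f)).star
    simpa [ContinuousLinearMap.adjoint_inner_right] using h
  rw [hinner.unique hsum, mul_comm]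
  exact hle.trans ((le_abs_self s).trans_eq (Complex.norm_real s).symm)
end

section
/- Let (Λ,Γ) be a bi-g-frame for U with respect to {V_j}_{j∈J} with bi-g-frame operator S_{Λ,Γ}. Then for every f ∈ U the reconstruction formula f = ∑_{j∈J} (Γ_j ∘ S_{Γ,Λ}⁻¹)* (Λ_j f) holds, i.e. the family ((S_{Γ,Λ}⁻¹)* Γ_j* Λ_j f)_{j∈J} is summable with sum f. -/
open scoped InnerProductSpace

variable {U : Type*} [NormedAddCommGroup U] [InnerProductSpace ℂ U] [CompleteSpace U]
variable {J : Type*} {V : J → Type*} [∀ j, NormedAddCommGroup (V j)]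
  [∀ j, InnerProductSpace ℂ (V j)] [∀ j, CompleteSpace (V j)]

/-- reconstruction formula f = ∑ⱼ (Γⱼ ∘ S_{Γ,Λ}⁻¹)* (Λⱼ f),
i.e. the family ((S_{Γ,Λ}⁻¹)* Γⱼ* Λⱼ f) is summable with sum f. -/
theorem biGFrame_reconstruction_right
    (Λ Γ : ∀ j : J, U →L[ℂ] V j) (C D : ℝ) (h : IsBiGFrame Λ Γ C D)
    (S T Tinv : U →L[ℂ] U)
    (hS : ∀ f : U,
      HasSum (fun j : J => (ContinuousLinearMap.adjoint (Γ j)) (Λ j f)) (S f))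
    (hT : ∀ f : U,
      HasSum (fun j : J => (ContinuousLinearMap.adjoint (Λ j)) (Γ j f)) (T f))
    (hleft : Tinv.comp T = ContinuousLinearMap.id ℂ U)
    (hright : T.comp Tinv = ContinuousLinearMap.id ℂ U) :
    ∀ f : U,
      HasSum
        (fun j : J =>
          (ContinuousLinearMap.adjoint Tinv)
            ((ContinuousLinearMap.adjoint (Γ j)) (Λ j f))) f := by
  have hST : ContinuousLinearMap.adjoint T = S := by
    refine ((ContinuousLinearMap.eq_adjoint_iff S T).mpr fun x y => ?_).symm
    have hx : HasSum (fun j => ⟪Λ j x, Γ j y⟫_ℂ) ⟪S x, y⟫_ℂ := by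
      simpa [ContinuousLinearMap.adjoint_inner_right] using ((hS x).mapL (innerSL ℂ y)).star
    have hy : HasSum (fun j => ⟪Λ j x, Γ j y⟫_ℂ) ⟪x, T y⟫_ℂ := by
      simpa [ContinuousLinearMap.adjoint_inner_right] using (hT y).mapL (innerSL ℂ x)
    exact hx.unique hy
  intro f
  have hsum := (hS f).mapL (ContinuousLinearMap.adjoint Tinv)
  have hf : ContinuousLinearMap.adjoint Tinv (S f) = f := by
    rw [← hST, ← ContinuousLinearMap.comp_apply, ← ContinuousLinearMap.adjoint_comp, hright,
      ContinuousLinearMap.adjoint_id, ContinuousLinearMap.id_apply]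
  rwa [hf] at hsum
end

section
/- Let (Λ,Γ) be a bi-g-frame for U with respect to {V_j}_{j∈J} with bounds C, D and bi-g-frame operators S_{Λ,Γ}, S_{Γ,Λ}. Define Λ̃_j = Λ_j ∘ S_{Λ,Γ}⁻¹ and Γ̃_j = Γ_j ∘ S_{Γ,Λ}⁻¹. Then (Λ̃,Γ̃) is a bi-g-Bessel sequence for U with respect to {V_j}_{j∈J} with bound 1/C; more precisely, for every f ∈ U, ∑_{j∈J} ⟨Λ̃_j f, Γ̃_j f⟩ = ⟨f, S_{Γ,Λ}⁻¹ f⟩ ≤ (1/C)‖f‖². -/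
open scoped InnerProductSpace

variable {U : Type*} [NormedAddCommGroup U] [InnerProductSpace ℂ U] [CompleteSpace U]
variable {J : Type*} {V : J → Type*} [∀ j, NormedAddCommGroup (V j)]
  [∀ j, InnerProductSpace ℂ (V j)] [∀ j, CompleteSpace (V j)]

/-- the canonical pair (Λ∘S_{Λ,Γ}⁻¹, Γ∘S_{Γ,Λ}⁻¹) is a bi-g-Bessel
sequence with bound 1 / C; more precisely, for every f the family of inner
products is summable with (real) sum ⟪f, S_{Γ,Λ}⁻¹ f⟫ ≤ (1/C) ‖f‖². -/
theorem biGFrame_canonical_dual_bessel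
    (Λ Γ : ∀ j : J, U →L[ℂ] V j) (C D : ℝ) (h : IsBiGFrame Λ Γ C D)
    (S T Sinv Tinv : U →L[ℂ] U)
    (hS : ∀ f : U,
      HasSum (fun j : J => (ContinuousLinearMap.adjoint (Γ j)) (Λ j f)) (S f))
    (hT : ∀ f : U,
      HasSum (fun j : J => (ContinuousLinearMap.adjoint (Λ j)) (Γ j f)) (T f))
    (hSl : Sinv.comp S = ContinuousLinearMap.id ℂ U)
    (hSr : S.comp Sinv = ContinuousLinearMap.id ℂ U)
    (hTl : Tinv.comp T = ContinuousLinearMap.id ℂ U)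
    (hTr : T.comp Tinv = ContinuousLinearMap.id ℂ U) :
    ∀ f : U, ∃ r : ℝ,
      HasSum (fun j : J => ⟪Λ j (Sinv f), Γ j (Tinv f)⟫_ℂ) ((r : ℂ)) ∧
      (r : ℂ) = ⟪f, Tinv f⟫_ℂ ∧
      r ≤ (1 / C) * ‖f‖ ^ 2 := by
  intro f
  obtain ⟨hC, -, hframe⟩ := h
  have hSf : S (Sinv f) = f := DFunLike.congr_fun hSr f
  have hTf : T (Tinv f) = f := DFunLike.congr_fun hTr f
  set g := Tinv f
  obtain ⟨s, hs, hle, -⟩ := hframe g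
  have hdual : HasSum (fun j : J => ⟪Λ j (Sinv f), Γ j g⟫_ℂ) ⟪f, g⟫_ℂ := by
    have h₁ := (innerSLFlip ℂ g).hasSum (hS (Sinv f))
    simpa [hSf, Function.comp_def, ContinuousLinearMap.adjoint_inner_left] using h₁
  have hgf : HasSum (fun j : J => ⟪Λ j g, Γ j g⟫_ℂ) ⟪g, f⟫_ℂ := by
    have h₂ := (innerSL ℂ g).hasSum (hT g)
    simpa [hTf, Function.comp_def, ContinuousLinearMap.adjoint_inner_right] using h₂
  have hfg : (s : ℂ) = ⟪f, g⟫_ℂ := by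
    rw [← inner_conj_symm, ← hs.unique hgf, Complex.conj_ofReal]
  refine ⟨s, hfg ▸ hdual, hfg, ?_⟩
  have hcs : s ≤ ‖f‖ * ‖g‖ := by
    have h₃ := re_inner_le_norm (𝕜 := ℂ) f g
    rwa [← hfg] at h₃
  rw [one_div, inv_mul_eq_div, le_div_iff₀ hC]
  nlinarith [sq_nonneg (‖f‖ - C * ‖g‖), mul_le_mul_of_nonneg_left hle hC.le,
    mul_le_mul_of_nonneg_left hcs hC.le]
end

section
/- Let (Λ,Γ) be a bi-g-frame for U with respect to {V_j}_{j∈J}, with Λ̃_j = Λ_j ∘ S_{Λ,Γ}⁻¹ and Γ̃_j = Γ_j ∘ S_{Γ,Λ}⁻¹. Suppose (g_j)_{j∈J} with g_j ∈ V_j is a family such that the family (Γ_j* g_j)_{j∈J} is summable with ∑_{j∈J} Γ_j* g_j = f. Then ∑_{j∈J} ‖g_j‖² = ∑_{j∈J} ⟨g_j, g_j − Γ̃_j f⟩ + ∑_{j∈J} ⟨Λ̃_j f, Γ̃_j f⟩ (all three families being summable, or, in case of divergence, the identity holding in the sense that both sides are given by convergent series whenever ∑_{j∈J}‖g_j‖²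 < ∞). -/
open scoped InnerProductSpace

variable {U : Type*} [NormedAddCommGroup U] [InnerProductSpace ℂ U] [CompleteSpace U]
variable {J : Type*} {V : J → Type*} [∀ j, NormedAddCommGroup (V j)]
  [∀ j, InnerProductSpace ℂ (V j)] [∀ j, CompleteSpace (V j)]

/-- If `∑ⱼ Γⱼ* gⱼ = f` then `∑ⱼ ⟪gⱼ, Γⱼ u⟫ = ⟪f, u⟫`. -/
theorem hasSum_inner_apply_of_hasSum_adjoint {Γ : ∀ j : J, U →L[ℂ] V j} {g : ∀ j : J, V j} {f : U}
    (hg : HasSum (fun j : J => (ContinuousLinearMap.adjoint (Γ j)) (g j)) f) (u : U) :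
    HasSum (fun j : J => ⟪g j, Γ j u⟫_ℂ) ⟪f, u⟫_ℂ := by
  have hcont : Continuous fun x : U => ⟪x, u⟫_ℂ := by fun_prop
  have hmap := hg.map (AddMonoidHom.mk' (fun x : U => ⟪x, u⟫_ℂ)
    fun x y => inner_add_left x y u) hcont
  simpa [Function.comp_def, ContinuousLinearMap.adjoint_inner_left] using hmap

/-- if f = ∑ⱼ Γⱼ* gⱼ and ∑ⱼ ‖gⱼ‖² < ∞, then
∑ⱼ ‖gⱼ‖² = ∑ⱼ ⟪gⱼ, gⱼ − Γ̃ⱼ f⟫ + ∑ⱼ ⟪Λ̃ⱼ f, Γ̃ⱼ f⟫, where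
Λ̃ⱼ = Λⱼ ∘ S_{Λ,Γ}⁻¹ and Γ̃ⱼ = Γⱼ ∘ S_{Γ,Λ}⁻¹, all three families being summable. -/
theorem biGFrame_minimal_norm_identity_left
    (Λ Γ : ∀ j : J, U →L[ℂ] V j) (C D : ℝ) (h : IsBiGFrame Λ Γ C D)
    (S T Sinv Tinv : U →L[ℂ] U)
    (hS : ∀ f : U,
      HasSum (fun j : J => (ContinuousLinearMap.adjoint (Γ j)) (Λ j f)) (S f))
    (hT : ∀ f : U,
      HasSum (fun j : J => (ContinuousLinearMap.adjoint (Λ j)) (Γ j f)) (T f))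
    (hSl : Sinv.comp S = ContinuousLinearMap.id ℂ U)
    (hSr : S.comp Sinv = ContinuousLinearMap.id ℂ U)
    (hTl : Tinv.comp T = ContinuousLinearMap.id ℂ U)
    (hTr : T.comp Tinv = ContinuousLinearMap.id ℂ U)
    (f : U) (g : ∀ j : J, V j)
    (hg : HasSum (fun j : J => (ContinuousLinearMap.adjoint (Γ j)) (g j)) f)
    (hg2 : Summable fun j : J => ‖g j‖ ^ 2) :
    ∃ a b : ℂ,
      HasSum (fun j : J => ⟪g j, g j - Γ j (Tinv f)⟫_ℂ) a ∧
      HasSum (fun j : J => ⟪Λ j (Sinv f), Γ j (Tinv f)⟫_ℂ) b ∧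
      HasSum (fun j : J => ((‖g j‖ ^ 2 : ℝ) : ℂ)) (a + b) := by
  have hnorm : HasSum (fun j : J => ((‖g j‖ ^ 2 : ℝ) : ℂ)) ((∑' j, ‖g j‖ ^ 2 : ℝ) : ℂ) :=
    Complex.hasSum_ofReal.mpr hg2.hasSum
  have hdual : HasSum (fun j : J => ⟪Λ j (Sinv f), Γ j (Tinv f)⟫_ℂ) ⟪f, Tinv f⟫_ℂ := by
    have hSf : S (Sinv f) = f := DFunLike.congr_fun hSr f
    simpa only [hSf] using hasSum_inner_apply_of_hasSum_adjoint (hS (Sinv f)) (Tinv f)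
  refine ⟨((∑' j, ‖g j‖ ^ 2 : ℝ) : ℂ) - ⟪f, Tinv f⟫_ℂ, _, ?_, hdual,
    by simpa only [sub_add_cancel] using hnorm⟩
  simpa [inner_sub_right, inner_self_eq_norm_sq_to_K] using
    hnorm.sub (hasSum_inner_apply_of_hasSum_adjoint hg (Tinv f))
end

section
/- Let (Λ,Γ) be a bi-g-frame for U with respect to {V_j}_{j∈J}, with Λ̃_j = Λ_j ∘ S_{Λ,Γ}⁻¹ and Γ̃_j = Γ_j ∘ S_{Γ,Λ}⁻¹. Suppose (g_j)_{j∈J} with g_j ∈ V_j is a family such that the family (Λ_j* g_j)_{j∈J} is summable with ∑_{j∈J} Λ_j* g_j = f and ∑_{j∈J}‖g_j‖² < ∞. Then ∑_{j∈J} ‖g_j‖² = ∑_{j∈J} ⟨g_j − Λ̃_j f, g_j⟩ + ∑_{j∈J} ⟨Λ̃_j f, Γ̃_j f⟩. -/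
open scoped InnerProductSpace

variable {U : Type*} [NormedAddCommGroup U] [InnerProductSpace ℂ U] [CompleteSpace U]
variable {J : Type*} {V : J → Type*} [∀ j, NormedAddCommGroup (V j)]
  [∀ j, InnerProductSpace ℂ (V j)] [∀ j, CompleteSpace (V j)]

/-- if f = ∑ⱼ Λⱼ* gⱼ and ∑ⱼ ‖gⱼ‖² < ∞, then
∑ⱼ ‖gⱼ‖² = ∑ⱼ ⟪gⱼ − Λ̃ⱼ f, gⱼ⟫ + ∑ⱼ ⟪Λ̃ⱼ f, Γ̃ⱼ f⟫, where
Λ̃ⱼ = Λⱼ ∘ S_{Λ,Γ}⁻¹ and Γ̃ⱼ = Γⱼ ∘ S_{Γ,Λ}⁻¹. -/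
theorem biGFrame_minimal_norm_identity_right
    (Λ Γ : ∀ j : J, U →L[ℂ] V j) (C D : ℝ) (h : IsBiGFrame Λ Γ C D)
    (S T Sinv Tinv : U →L[ℂ] U)
    (hS : ∀ f : U,
      HasSum (fun j : J => (ContinuousLinearMap.adjoint (Γ j)) (Λ j f)) (S f))
    (hT : ∀ f : U,
      HasSum (fun j : J => (ContinuousLinearMap.adjoint (Λ j)) (Γ j f)) (T f))
    (hSl : Sinv.comp S = ContinuousLinearMap.id ℂ U)
    (hSr : S.comp Sinv = ContinuousLinearMap.id ℂ U)
    (hTl : Tinv.comp T = ContinuousLinearMap.id ℂ U)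
    (hTr : T.comp Tinv = ContinuousLinearMap.id ℂ U)
    (f : U) (g : ∀ j : J, V j)
    (hg : HasSum (fun j : J => (ContinuousLinearMap.adjoint (Λ j)) (g j)) f)
    (hg2 : Summable fun j : J => ‖g j‖ ^ 2) :
    ∃ a b : ℂ,
      HasSum (fun j : J => ⟪g j - Λ j (Sinv f), g j⟫_ℂ) a ∧
      HasSum (fun j : J => ⟪Λ j (Sinv f), Γ j (Tinv f)⟫_ℂ) b ∧
      HasSum (fun j : J => ((‖g j‖ ^ 2 : ℝ) : ℂ)) (a + b) := by
  have hcross : ∀ (x y : U) (v : ∀ j : J, V j),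
      HasSum (fun j : J => (ContinuousLinearMap.adjoint (Λ j)) (v j)) y →
      HasSum (fun j : J => ⟪Λ j x, v j⟫_ℂ) ⟪x, y⟫_ℂ := by
    intro x y v hv
    simpa [ContinuousLinearMap.adjoint_inner_right] using (innerSL ℂ x).hasSum hv
  have hTf : T (Tinv f) = f := DFunLike.congr_fun hTr f
  have hsq : Summable fun j : J => ((‖g j‖ ^ 2 : ℝ) : ℂ) := Complex.summable_ofReal.mpr hg2
  have hdual := hcross (Sinv f) (T (Tinv f)) (fun j => Γ j (Tinv f)) (hT (Tinv f))
  rw [hTf] at hdual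
  refine ⟨(∑' j, ((‖g j‖ ^ 2 : ℝ) : ℂ)) - ⟪Sinv f, f⟫_ℂ, ⟪Sinv f, f⟫_ℂ, ?_, hdual, ?_⟩
  · simpa [inner_sub_left, inner_self_eq_norm_sq_to_K] using
      hsq.hasSum.sub (hcross (Sinv f) f g hg)
  · simpa only [sub_add_cancel] using hsq.hasSum
end

section
/- Let (Λ,Γ) be a bi-g-frame for U with respect to {V_j}_{j∈J}. Then Λ = {Λ_j}_{j∈J} is a g-Riesz basis for U with respect to {V_j}_{j∈J} if and only if Γ = {Γ_j}_{j∈J} is a g-Riesz basis for U with respect to {V_j}_{j∈J}. -/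
open scoped InnerProductSpace

variable {U : Type*} [NormedAddCommGroup U] [InnerProductSpace ℂ U] [CompleteSpace U]
variable {J : Type*} {V : J → Type*} [∀ j, NormedAddCommGroup (V j)]
  [∀ j, InnerProductSpace ℂ (V j)] [∀ j, CompleteSpace (V j)]

/-- A family Θ of bounded operators Θ j : U → V j is a g-Riesz basis for U with
respect to the V j: it is g-complete (Θ j f = 0 for all j implies f = 0) and
there are constants 0 < A, B such that for every finite subset F of J and every
choice of vectors g j ∈ V j,
A ∑_{j ∈ F} ‖g j‖² ≤ ‖∑_{j ∈ F} Θ j* (g j)‖² ≤ B ∑_{j ∈ F} ‖g j‖². -/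
def IsGRieszBasis (Θ : ∀ j : J, U →L[ℂ] V j) : Prop :=
  (∀ f : U, (∀ j : J, Θ j f = 0) → f = 0) ∧
  ∃ A B : ℝ, 0 < A ∧ 0 < B ∧
    ∀ (F : Finset J) (g : ∀ j : J, V j),
      A * ∑ j ∈ F, ‖g j‖ ^ 2 ≤
          ‖∑ j ∈ F, (ContinuousLinearMap.adjoint (Θ j)) (g j)‖ ^ 2 ∧
      ‖∑ j ∈ F, (ContinuousLinearMap.adjoint (Θ j)) (g j)‖ ^ 2 ≤
          B * ∑ j ∈ F, ‖g j‖ ^ 2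

/-- A family whose finite synthesis sums are bounded by `B` satisfies the Bessel inequality with
bound `B`. -/
lemma sum_norm_sq_le_of_synthesis_le {Θ : ∀ j : J, U →L[ℂ] V j} {B : ℝ} (hB0 : 0 ≤ B)
    (hB : ∀ (F : Finset J) (g : ∀ j : J, V j),
      ‖∑ j ∈ F, (ContinuousLinearMap.adjoint (Θ j)) (g j)‖ ^ 2 ≤ B * ∑ j ∈ F, ‖g j‖ ^ 2)
    (f : U) (F : Finset J) : ∑ j ∈ F, ‖Θ j f‖ ^ 2 ≤ B * ‖f‖ ^ 2 := by
  set s := ∑ j ∈ F, ‖Θ j f‖ ^ 2 with hs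
  set y := ∑ j ∈ F, (ContinuousLinearMap.adjoint (Θ j)) (Θ j f) with hy
  have hs0 : 0 ≤ s := Finset.sum_nonneg fun _ _ => by positivity
  have hyB : ‖y‖ ^ 2 ≤ B * s := hB F fun j => Θ j f
  have hinner : ⟪y, f⟫_ℂ = (s : ℂ) := by
    simp [hy, hs, ContinuousLinearMap.adjoint_inner_left]
  have hsy : s ≤ ‖y‖ * ‖f‖ := by
    have := norm_inner_le_norm (𝕜 := ℂ) y f
    rwa [hinner, Complex.norm_real, Real.norm_of_nonneg hs0] at this
  rcases hs0.eq_or_lt with h0 | hpos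
  · rw [← h0]; positivity
  · have h1 : s * s ≤ (B * ‖f‖ ^ 2) * s := by
      calc s * s ≤ (‖y‖ * ‖f‖) * (‖y‖ * ‖f‖) := mul_self_le_mul_self hs0 hsy
        _ = ‖y‖ ^ 2 * ‖f‖ ^ 2 := by ring
        _ ≤ (B * s) * ‖f‖ ^ 2 := by gcongr
        _ = _ := by ring
    exact le_of_mul_le_mul_right h1 hpos

omit [CompleteSpace U] [∀ j, CompleteSpace (V j)] in
/-- The analysis operator `f ↦ (Θ j f)_j` of a Bessel family, with values in the `ℓ²`-sum. -/
lemma exists_analysis_of_sum_norm_sq_le {Θ : ∀ j : J, U →L[ℂ] V j} {B : ℝ} (hB0 : 0 ≤ B)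
    (hB : ∀ (f : U) (F : Finset J), ∑ j ∈ F, ‖Θ j f‖ ^ 2 ≤ B * ‖f‖ ^ 2) :
    ∃ L : U →L[ℂ] lp V 2, ∀ f j, L f j = Θ j f := by
  have hmem (f : U) : Memℓp (fun j => Θ j f) 2 :=
    memℓp_gen' (C := B * ‖f‖ ^ 2) fun F => by simpa using hB f F
  let L₀ : U →ₗ[ℂ] lp V 2 :=
    { toFun := fun f => ⟨fun j => Θ j f, hmem f⟩
      map_add' := fun f g => Subtype.ext <| funext fun j => map_add (Θ j) f g
      map_smul' := fun c f => Subtype.ext <| funext fun j => map_smul (Θ j) c f }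
  refine ⟨L₀.mkContinuous (√B) fun f => ?_, fun f j => rfl⟩
  refine lp.norm_le_of_forall_sum_le (by norm_num) (by positivity) fun F => ?_
  have : (√B * ‖f‖) ^ 2 = B * ‖f‖ ^ 2 := by rw [mul_pow, Real.sq_sqrt hB0]
  simp only [ENNReal.toReal_ofNat, Real.rpow_ofNat, this]
  exact hB f F

/-- For a g-Riesz basis every finitely supported family is the analysis of some vector, with
equivalent norms. -/
lemma IsGRieszBasis.exists_interpolation {Θ : ∀ j : J, U →L[ℂ] V j} (hΘ : IsGRieszBasis Θ) :
    ∃ K : ℝ, 0 < K ∧ ∀ (F : Finset J) (g : ∀ j : J, V j), ∃ f : U,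
      (∀ j ∈ F, Θ j f = g j) ∧ (∀ j ∉ F, Θ j f = 0) ∧
      ∑ j ∈ F, ‖g j‖ ^ 2 ≤ K * ‖f‖ ^ 2 ∧ ‖f‖ ^ 2 ≤ K * ∑ j ∈ F, ‖g j‖ ^ 2 := by
  classical
  obtain ⟨hcomplete, A, B, hA, hB, hAB⟩ := hΘ
  have hbessel := sum_norm_sq_le_of_synthesis_le hB.le fun F g => (hAB F g).2
  obtain ⟨L, hL⟩ := exists_analysis_of_sum_norm_sq_le hB.le hbessel
  have hadj (F : Finset J) (g : ∀ j, V j) :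
      ContinuousLinearMap.adjoint L (∑ j ∈ F, lp.single 2 j (g j)) =
        ∑ j ∈ F, ContinuousLinearMap.adjoint (Θ j) (g j) := by
    refine ext_inner_right ℂ fun f => ?_
    simp [sum_inner, ContinuousLinearMap.adjoint_inner_left, lp.inner_single_left, hL]
  have hnorm (F : Finset J) (g : ∀ j, V j) :
      ‖∑ j ∈ F, lp.single 2 j (g j)‖ ^ 2 = ∑ j ∈ F, ‖g j‖ ^ 2 := by
    simpa using lp.norm_sum_single (p := 2) (by norm_num) g F
  have hbelow (h : lp V 2) : A * ‖h‖ ^ 2 ≤ ‖ContinuousLinearMap.adjoint L h‖ ^ 2 := by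
    have hsum : Filter.Tendsto (fun F : Finset J => ∑ j ∈ F, lp.single 2 j (h j))
        Filter.atTop (nhds h) := lp.hasSum_single (by norm_num) h
    refine le_of_tendsto_of_tendsto' ((hsum.norm.pow 2).const_mul A)
      ((((ContinuousLinearMap.adjoint L).continuous.tendsto h).comp hsum).norm.pow 2) fun F => ?_
    rw [Function.comp_apply, hadj, hnorm]
    exact (hAB F fun j => h j).1
  have hanti : AntilipschitzWith (√A⁻¹).toNNReal (ContinuousLinearMap.adjoint L) := by
    refine (ContinuousLinearMap.adjoint L).antilipschitz_of_bound fun h => ?_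
    rw [Real.coe_toNNReal _ (by positivity)]
    refine le_of_sq_le_sq ?_ (by positivity)
    rw [mul_pow, Real.sq_sqrt (by positivity), inv_mul_eq_div, le_div_iff₀' hA]
    exact hbelow h
  have hclosed : IsClosed (Set.range (ContinuousLinearMap.adjoint L)) :=
    hanti.isClosed_range (ContinuousLinearMap.adjoint L).uniformContinuous
  have hrange : (ContinuousLinearMap.adjoint L).range = ⊤ := by
    have : CompleteSpace (ContinuousLinearMap.adjoint L).range :=
      hclosed.completeSpace_coe
    rw [← Submodule.orthogonal_eq_bot_iff, ContinuousLinearMap.orthogonal_range,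
      ContinuousLinearMap.adjoint_adjoint, LinearMap.ker_eq_bot']
    exact fun f hf => hcomplete f fun j => by
      rw [← hL]
      exact congrFun (congrArg Subtype.val hf) j
  let e := ContinuousLinearEquiv.ofBijective (ContinuousLinearMap.adjoint L)
    (LinearMap.ker_eq_bot.mpr hanti.injective) hrange
  let R : lp V 2 →L[ℂ] U := ContinuousLinearMap.adjoint (e.symm : U →L[ℂ] lp V 2)
  have hLR (h : lp V 2) : L (R h) = h := by
    refine ext_inner_right ℂ fun k => ?_
    rw [← ContinuousLinearMap.adjoint_inner_right, ContinuousLinearMap.adjoint_inner_left]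
    exact congrArg _ (e.symm_apply_apply k)
  refine ⟨max B (‖R‖ ^ 2), by positivity, fun F g => ?_⟩
  have hval (j : J) : Θ j (R (∑ i ∈ F, lp.single 2 i (g i))) = if j ∈ F then g j else 0 := by
    rw [← hL, hLR]
    simp only [lp.coeFn_sum, lp.coeFn_single, Finset.sum_apply, Finset.sum_pi_single]
  refine ⟨R (∑ j ∈ F, lp.single 2 j (g j)), fun j hj => by rw [hval, if_pos hj],
    fun j hj => by rw [hval, if_neg hj], ?_, ?_⟩
  · calc ∑ j ∈ F, ‖g j‖ ^ 2 = ∑ j ∈ F, ‖Θ j (R (∑ i ∈ F, lp.single 2 i (g i)))‖ ^ 2 :=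
          Finset.sum_congr rfl fun j hj => by rw [hval, if_pos hj]
      _ ≤ B * _ := hbessel _ F
      _ ≤ _ := by gcongr; exact le_max_left _ _
  · calc ‖R (∑ j ∈ F, lp.single 2 j (g j))‖ ^ 2
        ≤ (‖R‖ * ‖∑ j ∈ F, lp.single 2 j (g j)‖) ^ 2 := by gcongr; exact R.le_opNorm _
      _ = ‖R‖ ^ 2 * ∑ j ∈ F, ‖g j‖ ^ 2 := by rw [mul_pow, hnorm]
      _ ≤ _ := by gcongr; exact le_max_right _ _

omit [CompleteSpace U] [∀ j, CompleteSpace (V j)] in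
lemma IsBiGFrame.symm {Λ Γ : ∀ j : J, U →L[ℂ] V j} {C D : ℝ} (h : IsBiGFrame Λ Γ C D) :
    IsBiGFrame Γ Λ C D := by
  refine ⟨h.1, h.2.1, fun f => ?_⟩
  obtain ⟨s, hs, hCs, hsD⟩ := h.2.2 f
  refine ⟨s, ?_, hCs, hsD⟩
  simpa using Complex.hasSum_conj'.mpr hs

omit [CompleteSpace U] [∀ j, CompleteSpace (V j)] in
/-- The real part of the sesquilinear form of a bi-g-frame obeys a Cauchy-Schwarz type bound. -/
lemma IsBiGFrame.re_le_of_hasSum {Λ Γ : ∀ j : J, U →L[ℂ] V j} {C D : ℝ}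
    (h : IsBiGFrame Λ Γ C D) {f y : U} {b : ℂ}
    (hb : HasSum (fun j => ⟪Λ j f, Γ j y⟫_ℂ) b) : 4 * b.re ≤ D * ‖f + y‖ ^ 2 := by
  obtain ⟨hC, -, hQ⟩ := h
  obtain ⟨s₁, h₁, -, hD₁⟩ := hQ (f + y)
  obtain ⟨s₂, h₂, hC₂, -⟩ := hQ (f - y)
  obtain ⟨s₃, h₃, -, -⟩ := hQ (f + Complex.I • y)
  obtain ⟨s₄, h₄, -, -⟩ := hQ (f - Complex.I • y)
  have hpol := (h₁.sub h₂).sub ((h₃.sub h₄).mul_left Complex.I)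
  have heq : 4 * b = (s₁ - s₂ : ℂ) - Complex.I * (s₃ - s₄) := by
    refine (hb.mul_left 4).unique ?_
    refine Eq.mp (congrArg (HasSum · _) (funext fun j => ?_)) hpol
    simp only [map_add, map_sub, map_smul, inner_add_left, inner_add_right, inner_sub_left,
      inner_sub_right, inner_smul_left, inner_smul_right, Complex.conj_I]
    linear_combination (2 * ⟪Λ j y, Γ j f⟫_ℂ - 2 * ⟪Λ j f, Γ j y⟫_ℂ) * Complex.I_sq
  have hre : 4 * b.re = s₁ - s₂ := by
    simpa using congrArg Complex.re heq
  have : 0 ≤ C * ‖f - y‖ ^ 2 := by positivity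
  linarith

lemma IsBiGFrame.isGRieszBasis_right {Λ Γ : ∀ j : J, U →L[ℂ] V j} {C D : ℝ}
    (h : IsBiGFrame Λ Γ C D) (hΛ : IsGRieszBasis Λ) : IsGRieszBasis Γ := by
  have hC := h.1
  have hD := h.2.1
  refine ⟨fun f hf => ?_, ?_⟩
  · obtain ⟨s, hs, hCs, -⟩ := h.2.2 f
    have hs0 : (s : ℂ) = 0 := hs.unique (by simp [hf, hasSum_zero])
    rw [Complex.ofReal_eq_zero.mp hs0] at hCs
    have : ‖f‖ ^ 2 ≤ 0 := nonpos_of_mul_nonpos_right hCs hC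
    simpa using this.antisymm (by positivity)
  obtain ⟨K, hK, hinterp⟩ := hΛ.exists_interpolation
  refine ⟨C ^ 2 / K, D ^ 2 * K, by positivity, by positivity, fun F g => ?_⟩
  obtain ⟨f, hfF, hfF', hgf, hfg⟩ := hinterp F g
  set x := ∑ j ∈ F, ContinuousLinearMap.adjoint (Γ j) (g j) with hx
  have hsum (y : U) : HasSum (fun j => ⟪Λ j f, Γ j y⟫_ℂ) ⟪x, y⟫_ℂ := by
    have : ⟪x, y⟫_ℂ = ∑ j ∈ F, ⟪Λ j f, Γ j y⟫_ℂ := by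
      rw [hx, sum_inner]
      exact Finset.sum_congr rfl fun j hj => by
        rw [hfF j hj, ContinuousLinearMap.adjoint_inner_left]
    rw [this]
    exact hasSum_sum_of_ne_finset_zero fun j hj => by simp [hfF' j hj]
  have hlow : C * ‖f‖ ≤ ‖x‖ := by
    obtain ⟨s, hs, hCs, -⟩ := h.2.2 f
    have hxs : ⟪x, f⟫_ℂ = (s : ℂ) := (hsum f).unique hs
    have hxf : s ≤ ‖x‖ * ‖f‖ := by
      have := norm_inner_le_norm (𝕜 := ℂ) x f
      rw [hxs, Complex.norm_real] at this
      exact (le_abs_self s).trans this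
    rcases (norm_nonneg f).eq_or_lt with h0 | hpos
    · simp [← h0]
    · exact le_of_mul_le_mul_right (by nlinarith) hpos
  have hup : ‖x‖ ^ 2 ≤ D ^ 2 * ‖f‖ ^ 2 := by
    have hre := h.re_le_of_hasSum (hsum (((D⁻¹ : ℝ) : ℂ) • x))
    rw [inner_smul_right, Complex.re_ofReal_mul, ← RCLike.re_eq_complex_re,
      inner_self_eq_norm_sq] at hre
    have htri : ‖f + ((D⁻¹ : ℝ) : ℂ) • x‖ ^ 2 ≤ 2 * (‖f‖ ^ 2 + (D⁻¹ * ‖x‖) ^ 2) := by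
      have h1 := norm_add_le f (((D⁻¹ : ℝ) : ℂ) • x)
      rw [norm_smul, Complex.norm_real, Real.norm_of_nonneg (by positivity)] at h1
      calc _ ≤ (‖f‖ + D⁻¹ * ‖x‖) ^ 2 := by gcongr
        _ ≤ _ := add_sq_le
    have h2 := hre.trans (mul_le_mul_of_nonneg_left htri hD.le)
    have h3 := mul_le_mul_of_nonneg_left h2 hD.le
    field_simp at h3
    linarith
  constructor
  · calc C ^ 2 / K * ∑ j ∈ F, ‖g j‖ ^ 2 ≤ C ^ 2 / K * (K * ‖f‖ ^ 2) := by gcongr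
      _ = (C * ‖f‖) ^ 2 := by field_simp
      _ ≤ ‖x‖ ^ 2 := by gcongr
  · calc ‖x‖ ^ 2 ≤ D ^ 2 * ‖f‖ ^ 2 := hup
      _ ≤ D ^ 2 * (K * ∑ j ∈ F, ‖g j‖ ^ 2) := by gcongr
      _ = _ := by ring

/-- if (Λ, Γ) is a bi-g-frame, then Λ is a g-Riesz basis iff Γ is
a g-Riesz basis. -/
theorem biGFrame_gRieszBasis_iff
    (Λ Γ : ∀ j : J, U →L[ℂ] V j) (C D : ℝ) (h : IsBiGFrame Λ Γ C D) :
    IsGRieszBasis Λ ↔ IsGRieszBasis Γ := by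
  exact ⟨h.isGRieszBasis_right, h.symm.isGRieszBasis_right⟩
end
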